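/- For each ε > 0 there exists a constant C > 0 such that for every 0 < p < 1, asymptotically almost surely Γ = G(n,p) has the following properties. For any disjoint X, Y ⊆ V(Γ) with |X| ≥ C p^{−1} log n and |Y| ≥ C p^{−1} log(en/|X|), we have e(X,Y) = (1±ε)p|X||Y| and e(X) ≤ 2p|X|². Furthermore, for every X ⊆ V(Γ) with |X| ≥ C p^{−1} log n, the number of vertices v ∈ V(Γ) with ||N_Γ(v,X)| − p|X|| > εp|X| is at most C p^{−1} log(en/|X|). -/

import Mathlib

open Filter

noncomputable section

/-- Number of ordered pairs `(x, y)` with `x ∈ X`, `y ∈ Y` adjacent in `G`;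
for disjoint `X`, `Y` this is the number of edges of `G` between `X` and `Y`. -/
def eXY {n : ℕ} (G : SimpleGraph (Fin n)) (X Y : Finset (Fin n)) : ℕ :=
  Nat.card {q : Fin n × Fin n // q.1 ∈ X ∧ q.2 ∈ Y ∧ G.Adj q.1 q.2}

/-- Number of edges of `G` inside `X`. -/
def eIn {n : ℕ} (G : SimpleGraph (Fin n)) (X : Finset (Fin n)) : ℕ := eXY G X X / 2

/-- The neighbourhood of `v` in `G` restricted to `U`. -/
def nbhdIn {n : ℕ} (G : SimpleGraph (Fin n)) (v : Fin n) (U : Finset (Fin n)) :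
    Finset (Fin n) :=
  @Finset.filter _ (fun u => G.Adj v u) (fun _ => Classical.propDecidable _) U

/-- Common neighbourhood of `{w j : j ∈ Λ}` in `G`, restricted to `U`. -/
def commonNbhd {n s : ℕ} (G : SimpleGraph (Fin n)) (w : Fin s → Fin n)
    (Λ : Finset (Fin s)) (U : Finset (Fin n)) : Finset (Fin n) :=
  @Finset.filter _ (fun u => ∀ j ∈ Λ, G.Adj (w j) u) (fun _ => Classical.propDecidable _) U

/-- The degree of `v` in `G`. -/
def degV {V : Type*} (G : SimpleGraph V) (v : V) : ℕ := Nat.card (G.neighborSet v)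

/-- The minimum degree of `G` is at least `x`. -/
def MinDegGe {V : Type*} (G : SimpleGraph V) (x : ℝ) : Prop := ∀ v, x ≤ (degV G v : ℝ)

/-- The maximum degree of `G` is at most `D`. -/
def MaxDegLe {V : Type*} (G : SimpleGraph V) (D : ℕ) : Prop := ∀ v, degV G v ≤ D

/-- `H` has a labelling of its `n` vertices by `1, …, n` in which the endpoints of
every edge are at distance at most `b`. -/
def HasBandwidthLe {n : ℕ} (H : SimpleGraph (Fin n)) (b : ℝ) : Prop :=
  ∃ L : Equiv.Perm (Fin n), ∀ u v, H.Adj u v → |((L u : ℕ) : ℝ) - ((L v : ℕ) : ℝ)| ≤ b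

/-- `v` lies in a triangle of `H`. -/
def InTriangle {n : ℕ} (H : SimpleGraph (Fin n)) (v : Fin n) : Prop :=
  ∃ u w, H.Adj v u ∧ H.Adj v w ∧ H.Adj u w

/-- `v` lies in a four-cycle of `H`. -/
def InC4 {n : ℕ} (H : SimpleGraph (Fin n)) (v : Fin n) : Prop :=
  ∃ a b c, v ≠ b ∧ a ≠ c ∧ H.Adj v a ∧ H.Adj a b ∧ H.Adj b c ∧ H.Adj c v

/-- `H` has degeneracy at most `D`: every (induced) subgraph has a vertex of degree
at most `D`. -/
def DegeneracyLe {n : ℕ} (H : SimpleGraph (Fin n)) (D : ℕ) : Prop :=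
  ∀ A : Finset (Fin n), A.Nonempty → ∃ v ∈ A, (nbhdIn H v A).card ≤ D

/-- `G` contains a copy of `H`. -/
def ContainsCopy {n m : ℕ} (G : SimpleGraph (Fin n)) (H : SimpleGraph (Fin m)) : Prop :=
  ∃ f : Fin m → Fin n, Function.Injective f ∧ ∀ u v, H.Adj u v → G.Adj (f u) (f v)

open Classical in
/-- The probability that the binomial random graph `G(n,p)` has the property `Q`. -/
def gnpProb (n : ℕ) (p : ℝ) (Q : SimpleGraph (Fin n) → Prop) : ℝ :=
  ∑ G : SimpleGraph (Fin n),
    if Q G then p ^ Nat.card G.edgeSet * (1 - p) ^ (n.choose 2 - Nat.card G.edgeSet) else 0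

/-- The property `Q` holds asymptotically almost surely in `G(n, p n)`. -/
def AAS (p : ℕ → ℝ) (Q : (n : ℕ) → SimpleGraph (Fin n) → Prop) : Prop :=
  Tendsto (fun n => gnpProb n (p n) (Q n)) atTop (nhds 1)

/-- `Γ` is `(p,ν)`-bijumbled. -/
def Bijumbled {n : ℕ} (Γ : SimpleGraph (Fin n)) (p ν : ℝ) : Prop :=
  ∀ X Y : Finset (Fin n), Disjoint X Y →
    |(eXY Γ X Y : ℝ) - p * X.card * Y.card| ≤ ν * Real.sqrt ((X.card : ℝ) * Y.card)

/-- `(X,Y)` is an `(ε,d,p)`-lower-regular pair in `G`. -/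
def LowerReg {n : ℕ} (G : SimpleGraph (Fin n)) (ε d p : ℝ) (X Y : Finset (Fin n)) : Prop :=
  ∀ X' ⊆ X, ∀ Y' ⊆ Y, ε * X.card ≤ X'.card → ε * Y.card ≤ Y'.card →
    d - ε ≤ (eXY G X' Y' : ℝ) / (p * X'.card * Y'.card)

/-- `(X,Y)` is an `(ε,d,p)`-regular pair in `G`. -/
def Reg {n : ℕ} (G : SimpleGraph (Fin n)) (ε d p : ℝ) (X Y : Finset (Fin n)) : Prop :=
  ∃ d', d ≤ d' ∧ ∀ X' ⊆ X, ∀ Y' ⊆ Y, ε * X.card ≤ X'.card → ε * Y.card ≤ Y'.card →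
    |(eXY G X' Y' : ℝ) / (p * X'.card * Y'.card) - d'| ≤ ε

/-- The degree conditions of `(ε,d,p)`-super-regularity of the pair `(X,Y)` for
`G ⊆ Γ`. -/
def SuperDeg {n : ℕ} (Γ G : SimpleGraph (Fin n)) (ε d p : ℝ) (X Y : Finset (Fin n)) : Prop :=
  (∀ x ∈ X, (d - ε) * max (p * Y.card) (((nbhdIn Γ x Y).card : ℝ) / 2)
      ≤ ((nbhdIn G x Y).card : ℝ)) ∧
  (∀ y ∈ Y, (d - ε) * max (p * X.card) (((nbhdIn Γ y X).card : ℝ) / 2)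
      ≤ ((nbhdIn G y X).card : ℝ))

/-- The backbone graph `B^k_r` on `[r] × [k]`: `(i,j)` and `(i',j')` are adjacent iff
`|i - i'| ≤ 1` and `j ≠ j'`. -/
def Bgraph (r k : ℕ) : SimpleGraph (Fin r × Fin k) :=
  SimpleGraph.fromRel fun a b =>
    ((a.1 : ℕ) ≤ (b.1 : ℕ) + 1 ∧ (b.1 : ℕ) ≤ (a.1 : ℕ) + 1) ∧ a.2 ≠ b.2

/-- The clique factor `K^k_r` on `[r] × [k]`: `(i,j)` and `(i',j')` are adjacent iff
`i = i'` and `j ≠ j'`. -/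
def Kgraph (r k : ℕ) : SimpleGraph (Fin r × Fin k) :=
  SimpleGraph.fromRel fun a b => a.1 = b.1 ∧ a.2 ≠ b.2

/-- `P` is a `k`-equitable partition of `U` indexed by `[r] × [k]`. -/
def IsEquitablePartitionOn {n r k : ℕ} (P : Fin r → Fin k → Finset (Fin n))
    (U : Finset (Fin n)) : Prop :=
  (∀ a b : Fin r × Fin k, a ≠ b → Disjoint (P a.1 a.2) (P b.1 b.2)) ∧
  (Finset.univ.biUnion (fun a : Fin r × Fin k => P a.1 a.2) = U) ∧
  (∀ i : Fin r, ∀ j j' : Fin k, ((P i j).card : ℤ) - ((P i j').card : ℤ) ≤ 1)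

/-- Block `t` (for `t ≥ 1`) of the labelling `L`, i.e. the vertices with labels in
`((t-1)·4kβn, t·4kβn]`, contains a vertex of colour zero. -/
def BlockHasZero {n k : ℕ} (β : ℝ) (L : Equiv.Perm (Fin n)) (σ : Fin n → Fin (k+1))
    (t : ℕ) : Prop :=
  ∃ v, σ v = 0 ∧ ((t : ℝ) - 1) * (4 * k * β * n) < ((L v : ℕ) : ℝ) + 1 ∧
    ((L v : ℕ) : ℝ) + 1 ≤ (t : ℝ) * (4 * k * β * n)

/-- The colouring `σ` is `(z, β)`-zero-free with respect to the labelling `L`: any two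
blocks containing colour zero are at least `z` apart. -/
def ZeroFree {n k : ℕ} (z β : ℝ) (L : Equiv.Perm (Fin n)) (σ : Fin n → Fin (k+1)) : Prop :=
  ∀ t₁ t₂ : ℕ, 1 ≤ t₁ → t₁ < t₂ → BlockHasZero β L σ t₁ → BlockHasZero β L σ t₂ →
    z ≤ (t₂ : ℝ) - (t₁ : ℝ)

end

open Classical in
lemma gnp_mgf (n : ℕ) (p : ℝ) (f : Sym2 (Fin n) → ℝ) :
    ∑ G : SimpleGraph (Fin n), p ^ Nat.card G.edgeSet * (1 - p) ^ (n.choose 2 - Nat.card G.edgeSet)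
      * ∏ e ∈ G.edgeFinset, f e
    = ∏ e ∈ (⊤ : SimpleGraph (Fin n)).edgeFinset, (p * f e + (1 - p)) := by
  rw [Finset.prod_add]
  refine Finset.sum_bij' (fun G _ => G.edgeFinset)
    (fun t _ => SimpleGraph.fromEdgeSet (t : Set (Sym2 (Fin n)))) ?_ ?_ ?_ ?_ ?_
  · intro G _
    simp only [Finset.mem_powerset]
    exact SimpleGraph.edgeFinset_mono le_top
  · intro t _; simp
  · intro G _; simp
  · intro t ht
    rw [Finset.mem_powerset] at ht
    ext e
    simp only [SimpleGraph.mem_edgeFinset, SimpleGraph.edgeSet_fromEdgeSet, Set.mem_sdiff,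
      Finset.mem_coe]
    constructor
    · exact fun h => h.1
    · intro h
      refine ⟨h, ?_⟩
      have := ht h
      rw [SimpleGraph.mem_edgeFinset] at this
      exact SimpleGraph.not_isDiag_of_mem_edgeSet _ this
  · intro G _
    have h1 : Nat.card G.edgeSet = G.edgeFinset.card := by
      rw [Nat.card_eq_fintype_card, SimpleGraph.edgeFinset_card]
    have h2 : ((⊤ : SimpleGraph (Fin n)).edgeFinset \ G.edgeFinset).card
        = n.choose 2 - G.edgeFinset.card := by
      rw [Finset.card_sdiff_of_subset (SimpleGraph.edgeFinset_mono le_top)]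
      congr 1
      have := SimpleGraph.card_edgeFinset_top_eq_card_choose_two (V := Fin n)
      rw [Fintype.card_fin] at this
      convert this
    rw [Finset.prod_mul_distrib, Finset.prod_const, Finset.prod_const, h1, h2]
    ring

/-- weight of an unordered pair -/
def wt {n : ℕ} (X Y : Finset (Fin n)) (e : Sym2 (Fin n)) : ℕ :=
  ((X ×ˢ Y).filter (fun q => s(q.1, q.2) = e)).card

lemma wt_le {n : ℕ} (X Y : Finset (Fin n)) (e : Sym2 (Fin n)) : wt X Y e ≤ 2 := by
  induction e with
  | _ a b =>
    unfold wt
    calc _ ≤ ({(a, b), (b, a)} : Finset (Fin n × Fin n)).card := by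
          apply Finset.card_le_card
          rintro ⟨x, y⟩ h
          simp at h ⊢
          tauto
      _ ≤ 2 := Finset.card_le_two

open Classical in
lemma eXY_eq {n : ℕ} (G : SimpleGraph (Fin n)) (X Y : Finset (Fin n)) :
    eXY G X Y = ((X ×ˢ Y).filter (fun q => G.Adj q.1 q.2)).card := by
  unfold eXY
  rw [Nat.card_eq_fintype_card, Fintype.card_subtype]
  congr 1
  ext q
  simp [and_assoc]

open Classical in
lemma eXY_eq_wt {n : ℕ} (G : SimpleGraph (Fin n)) (X Y : Finset (Fin n)) :
    eXY G X Y = ∑ e ∈ G.edgeFinset, wt X Y e := by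
  rw [eXY_eq, Finset.card_eq_sum_card_fiberwise (f := fun q => s(q.1, q.2)) (t := G.edgeFinset)]
  · refine Finset.sum_congr rfl fun e he => ?_
    unfold wt
    congr 1
    ext q
    simp only [Finset.mem_filter, and_assoc]
    constructor
    · rintro ⟨h1, h2, h3⟩; exact ⟨h1, h3⟩
    · rintro ⟨h1, h3⟩
      refine ⟨h1, ?_, h3⟩
      rw [← h3] at he
      simpa using he
  · intro q hq
    simp at hq ⊢
    exact hq.2

lemma eXY_top_le {n : ℕ} (X Y : Finset (Fin n)) : eXY ⊤ X Y ≤ X.card * Y.card := by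
  classical
  have h' : eXY ⊤ X Y =
      ((X ×ˢ Y).filter (fun q => (⊤ : SimpleGraph (Fin n)).Adj q.1 q.2)).card := by
    rw [eXY_eq]; congr
  rw [h', ← Finset.card_product]
  exact Finset.card_filter_le _ _

lemma eXY_top_ge {n : ℕ} (X Y : Finset (Fin n)) : X.card * Y.card ≤ eXY ⊤ X Y + Y.card := by
  classical
  have h := Finset.card_filter_add_card_filter_not (s := X ×ˢ Y)
    (fun q : Fin n × Fin n => (⊤ : SimpleGraph (Fin n)).Adj q.1 q.2)
  have h' : eXY ⊤ X Y =
      ((X ×ˢ Y).filter (fun q => (⊤ : SimpleGraph (Fin n)).Adj q.1 q.2)).card := by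
    rw [eXY_eq]; congr
  rw [h', ← Finset.card_product, ← h]
  refine Nat.add_le_add_left ?_ _
  refine Finset.card_le_card_of_injOn (fun q => q.2) ?_ ?_
  · intro q hq
    simp at hq ⊢; exact hq.1.2
  · rintro ⟨a, b⟩ hq ⟨c, d⟩ hq' h
    simp at hq hq' h ⊢
    simp [hq.2, hq'.2, h]

open Classical in
lemma eXY_eq_nbhd {n : ℕ} (G : SimpleGraph (Fin n)) (X Y : Finset (Fin n)) :
    eXY G X Y = ∑ v ∈ Y, (nbhdIn G v X).card := by
  rw [eXY_eq, Finset.card_filter, Finset.sum_product_right]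
  refine Finset.sum_congr rfl fun v _ => ?_
  unfold nbhdIn
  rw [Finset.card_filter]
  simp [G.adj_comm]

/-- weight of a graph -/
noncomputable def gw (n : ℕ) (p : ℝ) (G : SimpleGraph (Fin n)) : ℝ :=
  p ^ Nat.card G.edgeSet * (1 - p) ^ (n.choose 2 - Nat.card G.edgeSet)

lemma gw_nonneg (n : ℕ) (p : ℝ) (h0 : 0 < p) (h1 : p < 1) (G : SimpleGraph (Fin n)) :
    0 ≤ gw n p G := by
  have : 0 < 1 - p := by linarith
  unfold gw; positivity

lemma gw_sum (n : ℕ) (p : ℝ) : ∑ G, gw n p G = 1 := by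
  classical
  have := gnp_mgf n p (fun _ => 1)
  simpa [gw] using this

lemma gnpProb_eq (n : ℕ) (p : ℝ) (Q : SimpleGraph (Fin n) → Prop) [DecidablePred Q] :
    gnpProb n p Q = ∑ G, if Q G then gw n p G else 0 := by
  unfold gnpProb gw
  refine Finset.sum_congr rfl fun G _ => ?_
  congr

lemma gnpProb_mono (n : ℕ) (p : ℝ) (h0 : 0 < p) (h1 : p < 1) (Q R : SimpleGraph (Fin n) → Prop)
    (h : ∀ G, Q G → R G) : gnpProb n p Q ≤ gnpProb n p R := by
  classical
  unfold gnpProb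
  refine Finset.sum_le_sum fun G _ => ?_
  have := gw_nonneg n p h0 h1 G
  unfold gw at this
  by_cases hq : Q G
  · simp [hq, h G hq]
  · simp only [hq, if_false]; split_ifs <;> first | exact this | exact le_rfl

lemma gnpProb_true (n : ℕ) (p : ℝ) : gnpProb n p (fun _ => True) = 1 := by
  simpa [gnpProb, gw] using gw_sum n p

lemma mgf_edge (p : ℝ) (h0 : 0 < p) (t : ℝ) (ht : |t| ≤ 1 / 2) (w : ℕ) (hw2 : w ≤ 2) :
    p * Real.exp (t * w) + (1 - p) ≤ Real.exp (p * (t + 2 * t ^ 2) * w) := by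
  have hw : (w : ℝ) ≤ 2 := by exact_mod_cast hw2
  have hw0 : (0 : ℝ) ≤ w := by positivity
  have habs : |t * w| ≤ 1 := by
    rw [abs_mul, abs_of_nonneg hw0]
    nlinarith [abs_nonneg t]
  have h2 : Real.exp (t * w) ≤ 1 + t * w + (t * w) ^ 2 := by
    have := (abs_le.1 (Real.abs_exp_sub_one_sub_id_le habs)).2
    linarith
  have h3 : (t * w) ^ 2 ≤ 2 * t ^ 2 * w := by
    have : (w : ℝ) * w ≤ 2 * w := by nlinarith
    nlinarith [sq_nonneg t]
  have h4 := Real.add_one_le_exp (p * (t + 2 * t ^ 2) * (w : ℝ))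
  refine le_trans ?_ h4
  nlinarith

/-- Exponential moment bound. -/
lemma mgf_le (n : ℕ) (p : ℝ) (h0 : 0 < p) (h1 : p < 1) (X Y : Finset (Fin n)) (t : ℝ)
    (ht : |t| ≤ 1 / 2) :
    ∑ G, gw n p G * Real.exp (t * eXY G X Y) ≤
      Real.exp (p * (t + 2 * t ^ 2) * eXY ⊤ X Y) := by
  classical
  have e1 : ∀ G : SimpleGraph (Fin n), Real.exp (t * eXY G X Y)
      = ∏ e ∈ G.edgeFinset, Real.exp (t * wt X Y e) := by
    intro G
    rw [eXY_eq_wt, ← Real.exp_sum]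
    push_cast
    rw [Finset.mul_sum]
  simp only [e1, gw]
  rw [gnp_mgf, eXY_eq_wt]
  push_cast
  rw [Finset.mul_sum, Real.exp_sum]
  have hp1 : 0 < 1 - p := by linarith
  have key : ∀ e : Sym2 (Fin n), p * Real.exp (t * wt X Y e) + (1 - p) ≤
      Real.exp (p * (t + 2 * t ^ 2) * wt X Y e) := fun e => mgf_edge p h0 t ht _ (wt_le X Y e)
  refine (Finset.prod_le_prod (fun e _ => ?_) (fun e _ => key e)).trans_eq ?_
  · have := Real.exp_pos (t * wt X Y e)
    positivity
  · congr!

lemma markov_exp (n : ℕ) (p : ℝ) (h0 : 0 < p) (h1 : p < 1) (X Y : Finset (Fin n)) (t a : ℝ)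
    (ht : |t| ≤ 1 / 2) :
    gnpProb n p (fun G => t * a ≤ t * eXY G X Y) ≤
      Real.exp (p * (t + 2 * t ^ 2) * eXY ⊤ X Y - t * a) := by
  classical
  have := mgf_le n p h0 h1 X Y t ht
  rw [Real.exp_sub, le_div_iff₀ (Real.exp_pos _)]
  refine le_trans ?_ this
  unfold gnpProb
  rw [Finset.sum_mul]
  refine Finset.sum_le_sum fun G _ => ?_
  have h := gw_nonneg n p h0 h1 G
  split_ifs with hq
  · change gw n p G * _ ≤ _
    gcongr
  · rw [zero_mul]; positivity

/-- Two-sided tail bound. -/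
lemma tail (n : ℕ) (p δ : ℝ) (h0 : 0 < p) (h1 : p < 1) (hδ : 0 < δ) (hδ1 : δ ≤ 1)
    (X Y : Finset (Fin n)) (hX : 4 / δ ≤ X.card) :
    gnpProb n p (fun G => ¬ |(eXY G X Y : ℝ) - p * X.card * Y.card| ≤ δ * (p * X.card * Y.card))
      ≤ 2 * Real.exp (-(δ ^ 2 / 16) * (p * X.card * Y.card)) := by
  classical
  have hab : ∀ G : SimpleGraph (Fin n),
      (¬ |(eXY G X Y : ℝ) - p * X.card * Y.card| ≤ δ * (p * X.card * Y.card)) →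
      ((δ / 4) * ((1 + δ) * (p * X.card * Y.card)) ≤ (δ / 4) * eXY G X Y ∨
      (-(δ / 4)) * ((1 - δ) * (p * X.card * Y.card)) ≤ (-(δ / 4)) * eXY G X Y) := by
    intro G h
    rw [abs_le, not_and_or] at h
    rcases h with h | h
    · right; push Not at h; nlinarith
    · left; push Not at h; nlinarith
  have hW1 : (eXY (⊤ : SimpleGraph (Fin n)) X Y : ℝ) ≤ X.card * Y.card := by
    exact_mod_cast eXY_top_le X Y
  have hW2 : (X.card : ℝ) * Y.card ≤ eXY (⊤ : SimpleGraph (Fin n)) X Y + Y.card := by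
    exact_mod_cast eXY_top_ge X Y
  have hA := markov_exp n p h0 h1 X Y (δ / 4) ((1 + δ) * (p * X.card * Y.card))
    (by rw [abs_le]; constructor <;> linarith)
  have hB := markov_exp n p h0 h1 X Y (-(δ / 4)) ((1 - δ) * (p * X.card * Y.card))
    (by rw [abs_le]; constructor <;> linarith)
  have hsum : gnpProb n p (fun G => ¬ |(eXY G X Y : ℝ) - p * X.card * Y.card| ≤
        δ * (p * X.card * Y.card)) ≤
      gnpProb n p (fun G => (δ / 4) * ((1 + δ) * (p * X.card * Y.card)) ≤ (δ / 4) * eXY G X Y) +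
      gnpProb n p (fun G =>
        (-(δ / 4)) * ((1 - δ) * (p * X.card * Y.card)) ≤ (-(δ / 4)) * eXY G X Y) := by
    unfold gnpProb
    rw [← Finset.sum_add_distrib]
    refine Finset.sum_le_sum fun G _ => ?_
    have h := gw_nonneg n p h0 h1 G
    unfold gw at h
    have := hab G
    by_cases hq : |(eXY G X Y : ℝ) - p * X.card * Y.card| ≤ δ * (p * X.card * Y.card)
    · rw [if_neg (not_not.2 hq)]
      refine add_nonneg ?_ ?_ <;> split_ifs <;> first | exact h | exact le_rfl
    · rw [if_pos hq]
      rcases this hq with h' | h'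
      · rw [if_pos h']; split_ifs <;> linarith
      · rw [if_pos h']; split_ifs <;> linarith
  set x : ℝ := (X.card : ℝ)
  set y : ℝ := (Y.card : ℝ)
  set W : ℝ := (eXY (⊤ : SimpleGraph (Fin n)) X Y : ℝ)
  have hy : 0 ≤ y := by positivity
  have hx : 0 < x := lt_of_lt_of_le (by positivity) hX
  have hxy : 0 ≤ p * x * y := by positivity
  have hxd : 4 ≤ x * δ := by rwa [div_le_iff₀ hδ] at hX
  have hyy : y ≤ δ / 4 * (x * y) := by nlinarith
  have EA : p * (δ / 4 + 2 * (δ / 4) ^ 2) * W - δ / 4 * ((1 + δ) * (p * x * y))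
      ≤ -(δ ^ 2 / 16) * (p * x * y) := by
    have : p * (δ / 4 + 2 * (δ / 4) ^ 2) * W ≤ p * (δ / 4 + 2 * (δ / 4) ^ 2) * (x * y) := by
      gcongr
    have h2 : 0 ≤ δ ^ 2 * (p * x * y) := by positivity
    nlinarith
  have EB : p * (-(δ / 4) + 2 * (-(δ / 4)) ^ 2) * W - -(δ / 4) * ((1 - δ) * (p * x * y))
      ≤ -(δ ^ 2 / 16) * (p * x * y) := by
    have hc : 0 ≤ p * (δ / 4 - 2 * (δ / 4) ^ 2) := by
      apply mul_nonneg h0.le; nlinarith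
    have hW3 : (1 - δ / 4) * (x * y) ≤ W := by linarith
    have h3 := mul_le_mul_of_nonneg_left hW3 hc
    have h2 : 0 ≤ δ ^ 3 * (p * x * y) := by positivity
    nlinarith
  have := Real.exp_le_exp.2 EA
  have := Real.exp_le_exp.2 EB
  linarith

lemma choose_le_exp (n x : ℕ) (hx : 0 < x) (hxn : x ≤ n) :
    (n.choose x : ℝ) ≤ Real.exp (x * Real.log (Real.exp 1 * n / x)) := by
  have hn : 0 < n := by omega
  have hx' : (0 : ℝ) < x := by exact_mod_cast hx
  have hn' : (0 : ℝ) < n := by exact_mod_cast hn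
  have h1 := Nat.choose_le_pow_div (α := ℝ) x n
  have h2 := Real.pow_div_factorial_le_exp (x : ℝ) hx'.le x
  have h3 : Real.exp (x * Real.log (Real.exp 1 * n / x)) = (Real.exp 1 * n / x) ^ x := by
    rw [mul_comm, ← Real.rpow_def_of_pos (by positivity), Real.rpow_natCast]
  rw [h3]
  refine h1.trans ?_
  rw [div_pow, mul_pow, ← Real.exp_nat_mul, mul_one]
  rw [div_le_iff₀ (by positivity)] at h2 ⊢
  rw [div_mul_eq_mul_div, le_div_iff₀ (by positivity)]
  have : (0 : ℝ) ≤ (n : ℝ) ^ x := by positivity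
  nlinarith

lemma choose_le_exp' (n y : ℕ) (hn : 0 < n) :
    (n.choose y : ℝ) ≤ Real.exp (y * Real.log n) := by
  have hn' : (0 : ℝ) < n := by exact_mod_cast hn
  rw [mul_comm, ← Real.rpow_def_of_pos hn', Real.rpow_natCast]
  exact_mod_cast Nat.choose_le_pow n y

/-- the size conditions -/
def Cond (n : ℕ) (p K : ℝ) (X Y : Finset (Fin n)) : Prop :=
  K / p * Real.log n ≤ (X.card : ℝ) ∧
    K / p * Real.log (Real.exp 1 * n / X.card) ≤ (Y.card : ℝ)

lemma log_ge_one {n : ℕ} (hn : 3 ≤ n) : 1 ≤ Real.log n := by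
  rw [Real.le_log_iff_exp_le (by exact_mod_cast (by omega : 0 < n))]
  have : (3 : ℝ) ≤ n := by exact_mod_cast hn
  linarith [Real.exp_one_lt_d9]

lemma card_lower {n : ℕ} {p δ : ℝ} (hn : 3 ≤ n) (h0 : 0 < p) (h1 : p < 1) (hδ : 0 < δ)
    (X : Finset (Fin n)) (hX : 128 / δ ^ 2 / p * Real.log n ≤ (X.card : ℝ)) :
    128 / δ ^ 2 ≤ (X.card : ℝ) := by
  refine le_trans ?_ hX
  have hl := log_ge_one hn
  have : 128 / δ ^ 2 ≤ 128 / δ ^ 2 / p := by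
    rw [le_div_iff₀ h0]
    have : 0 < 128 / δ ^ 2 := by positivity
    nlinarith
  have h3 : 0 < 128 / δ ^ 2 := by positivity
  nlinarith

lemma L_ge_one {n : ℕ} (X : Finset (Fin n)) (hX : 0 < X.card) :
    1 ≤ Real.log (Real.exp 1 * n / X.card) := by
  have hx' : (0 : ℝ) < X.card := by exact_mod_cast hX
  have hxn : X.card ≤ n := by simpa using Finset.card_le_univ X
  have hxn' : (X.card : ℝ) ≤ n := by exact_mod_cast hxn
  have hn' : (0 : ℝ) < n := lt_of_lt_of_le hx' hxn'
  rw [Real.le_log_iff_exp_le (by positivity), le_div_iff₀ hx']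
  gcongr

lemma pair_bound (n : ℕ) (p δ : ℝ) (hn : 3 ≤ n) (h0 : 0 < p) (h1 : p < 1) (hδ : 0 < δ)
    (hδ1 : δ ≤ 1) (X Y : Finset (Fin n)) (h : Cond n p (128 / δ ^ 2) X Y) :
    gnpProb n p (fun G => ¬ |(eXY G X Y : ℝ) - p * X.card * Y.card| ≤ δ * (p * X.card * Y.card))
      ≤ 2 / (n : ℝ) ^ 3 * ((1 / (n.choose X.card : ℝ)) * (1 / (n.choose Y.card : ℝ))) := by
  obtain ⟨hX, hY⟩ := h
  have hxl := card_lower hn h0 h1 hδ X hX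
  have hdd : 4 / δ ≤ 128 / δ ^ 2 := by
    rw [div_le_div_iff₀ hδ (by positivity)]; nlinarith
  have hx0' : (0 : ℝ) < X.card := lt_of_lt_of_le (by positivity) hxl
  have hx0 : 0 < X.card := by exact_mod_cast hx0'
  have hL := L_ge_one X hx0
  have hl := log_ge_one hn
  have hxn : X.card ≤ n := by simpa using Finset.card_le_univ X
  have hyn : Y.card ≤ n := by simpa using Finset.card_le_univ Y
  refine (tail n p δ h0 h1 hδ hδ1 X Y (hdd.trans hxl)).trans ?_
  have c1 := choose_le_exp n X.card hx0 hxn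
  have c2 := choose_le_exp' n Y.card (by omega)
  have p1 : (0 : ℝ) < n.choose X.card := by exact_mod_cast Nat.choose_pos hxn
  have p2 : (0 : ℝ) < n.choose Y.card := by exact_mod_cast Nat.choose_pos hyn
  have hn0 : (0 : ℝ) < n := by positivity
  have hy0' : (0 : ℝ) < Y.card := lt_of_lt_of_le (by positivity) hY
  have hy1 : (1 : ℝ) ≤ Y.card := by
    have : 0 < Y.card := by exact_mod_cast hy0'
    exact_mod_cast this
  have c3 : (n : ℝ) ^ 3 = Real.exp (3 * Real.log n) := by
    rw [mul_comm, ← Real.rpow_def_of_pos hn0]; norm_cast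
  set x : ℝ := (X.card : ℝ)
  set y : ℝ := (Y.card : ℝ)
  set L := Real.log (Real.exp 1 * n / x)
  set l := Real.log n
  have k1 : 8 * l ≤ δ ^ 2 / 16 * (p * x) := by
    have : 128 / δ ^ 2 / p * l * (δ ^ 2 / 16 * p) ≤ x * (δ ^ 2 / 16 * p) := by gcongr
    have e : 128 / δ ^ 2 / p * l * (δ ^ 2 / 16 * p) = 8 * l := by field_simp; ring
    linarith
  have k2 : 8 * L ≤ δ ^ 2 / 16 * (p * y) := by
    have : 128 / δ ^ 2 / p * L * (δ ^ 2 / 16 * p) ≤ y * (δ ^ 2 / 16 * p) := by gcongr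
    have e : 128 / δ ^ 2 / p * L * (δ ^ 2 / 16 * p) = 8 * L := by field_simp; ring
    linarith
  have k3 := mul_le_mul_of_nonneg_right k1 hy0'.le
  have k4 := mul_le_mul_of_nonneg_right k2 hx0'.le
  have key : -(δ ^ 2 / 16) * (p * x * y) ≤ -(3 * l + x * L + y * l) := by
    have a1 : 0 ≤ x * L := by positivity
    have a2 : l ≤ y * l := by nlinarith
    nlinarith
  calc 2 * Real.exp (-(δ ^ 2 / 16) * (p * x * y)) ≤ 2 * Real.exp (-(3 * l + x * L + y * l)) := by
        gcongr
    _ = 2 / Real.exp (3 * l) * ((1 / Real.exp (x * L)) * (1 / Real.exp (y * l))) := by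
        rw [Real.exp_neg, Real.exp_add, Real.exp_add]; field_simp
    _ ≤ _ := by
        rw [← c3]; gcongr

open Classical in
lemma union_bound (n : ℕ) (p : ℝ) (h0 : 0 < p) (h1 : p < 1)
    {ι : Type*} [Fintype ι] (c : ι → Prop) (Q : ι → SimpleGraph (Fin n) → Prop)
    (b : ι → ℝ) (hb0 : ∀ i, 0 ≤ b i) (hb : ∀ i, c i → gnpProb n p (fun G => ¬ Q i G) ≤ b i) :
    1 - ∑ i, b i ≤ gnpProb n p (fun G => ∀ i, c i → Q i G) := by
  have step : 1 ≤ gnpProb n p (fun G => ∀ i, c i → Q i G) +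
      ∑ i, gnpProb n p (fun G => c i ∧ ¬ Q i G) := by
    rw [← gw_sum n p]
    simp only [gnpProb_eq]
    rw [Finset.sum_comm, ← Finset.sum_add_distrib]
    refine Finset.sum_le_sum fun G _ => ?_
    have h := gw_nonneg n p h0 h1 G
    have hnn : ∀ i, 0 ≤ if c i ∧ ¬ Q i G then gw n p G else 0 := by
      intro i; split_ifs <;> simp [h]
    by_cases hq : ∀ i, c i → Q i G
    · rw [if_pos hq]
      exact le_add_of_nonneg_right (Finset.sum_nonneg fun i _ => hnn i)
    · rw [if_neg hq, zero_add]
      push Not at hq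
      obtain ⟨i, hi⟩ := hq
      have := Finset.single_le_sum (f := fun i => if c i ∧ ¬ Q i G then gw n p G else 0)
        (fun i _ => hnn i) (Finset.mem_univ i)
      simp only [if_pos hi] at this
      exact this
  have : ∑ i, gnpProb n p (fun G => c i ∧ ¬ Q i G) ≤ ∑ i, b i := by
    refine Finset.sum_le_sum fun i _ => ?_
    by_cases hc : c i
    · simpa [hc] using hb i hc
    · simpa [hc, gnpProb] using hb0 i
  linarith

lemma sum_inv_choose (n : ℕ) :
    ∑ X : Finset (Fin n), 1 / (n.choose X.card : ℝ) = n + 1 := by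
  have := Finset.sum_powerset_apply_card (x := (Finset.univ : Finset (Fin n)))
    (fun k => 1 / (n.choose k : ℝ))
  rw [Finset.powerset_univ] at this
  rw [this]
  simp only [Finset.card_univ, Fintype.card_fin, nsmul_eq_mul]
  rw [Finset.sum_congr rfl (g := fun _ => (1 : ℝ))]
  · simp
  · intro k hk
    have : (n.choose k : ℝ) ≠ 0 := by
      have := Nat.choose_pos (n := n) (k := k) (by simp at hk; omega)
      positivity
    field_simp

lemma good_prob (n : ℕ) (p δ : ℝ) (hn : 3 ≤ n) (h0 : 0 < p) (h1 : p < 1) (hδ : 0 < δ)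
    (hδ1 : δ ≤ 1) :
    1 - 2 / (n : ℝ) ^ 3 * ((n + 1) * (n + 1)) ≤ gnpProb n p (fun G =>
      ∀ i : Finset (Fin n) × Finset (Fin n), Cond n p (128 / δ ^ 2) i.1 i.2 →
      |(eXY G i.1 i.2 : ℝ) - p * i.1.card * i.2.card| ≤ δ * (p * i.1.card * i.2.card)) := by
  refine le_trans (le_of_eq ?_) (union_bound n p h0 h1
    (fun i : Finset (Fin n) × Finset (Fin n) => Cond n p (128 / δ ^ 2) i.1 i.2)
    (fun i G => |(eXY G i.1 i.2 : ℝ) - p * i.1.card * i.2.card| ≤ δ * (p * i.1.card * i.2.card))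
    (fun i => 2 / (n : ℝ) ^ 3 * ((1 / (n.choose i.1.card : ℝ)) * (1 / (n.choose i.2.card : ℝ))))
    (fun i => by positivity)
    (fun i hi => pair_bound n p δ hn h0 h1 hδ hδ1 i.1 i.2 hi))
  rw [← Finset.mul_sum, ← sum_inv_choose, Fintype.sum_prod_type, Finset.sum_mul_sum]

lemma lim_bound : Tendsto (fun n : ℕ => 1 - 2 / (n : ℝ) ^ 3 * (((n : ℝ) + 1) * (n + 1))) atTop (nhds 1) := by
  have h := tendsto_one_div_atTop_nhds_zero_nat (𝕜 := ℝ)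
  have h2 : Tendsto (fun n : ℕ => 1 - 2 * (1 / (n : ℝ)) * (1 + 1 / (n : ℝ)) * (1 + 1 / (n : ℝ)))
      atTop (nhds (1 - 2 * 0 * (1 + 0) * (1 + 0))) :=
    tendsto_const_nhds.sub (((tendsto_const_nhds.mul h).mul (tendsto_const_nhds.add h)).mul
      (tendsto_const_nhds.add h))
  simp only [mul_zero, zero_mul, sub_zero] at h2
  refine h2.congr' ?_
  filter_upwards [eventually_gt_atTop 0] with n hn
  have : (n : ℝ) ≠ 0 := by positivity
  field_simp

/-- **Proposition 16** of "The bandwidth theorem in sparse graphs": typical edge counts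
and degrees in `G(n,p)`. -/
theorem gnp_edge_and_degree_concentration (ε : ℝ) (hε : 0 < ε) :
    ∃ C : ℝ, 0 < C ∧
      ∀ p : ℝ, 0 < p → p < 1 →
        AAS (fun _ => p) (fun n Γ =>
          (∀ X Y : Finset (Fin n), Disjoint X Y →
            C / p * Real.log n ≤ (X.card : ℝ) →
            C / p * Real.log (Real.exp 1 * n / X.card) ≤ (Y.card : ℝ) →
            |(eXY Γ X Y : ℝ) - p * X.card * Y.card| ≤ ε * (p * X.card * Y.card)) ∧
          (∀ X : Finset (Fin n), C / p * Real.log n ≤ (X.card : ℝ) →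
            (eIn Γ X : ℝ) ≤ 2 * p * (X.card : ℝ) ^ 2) ∧
          (∀ X : Finset (Fin n), C / p * Real.log n ≤ (X.card : ℝ) →
            (Nat.card {v : Fin n |
                ε * (p * X.card) < |((nbhdIn Γ v X).card : ℝ) - p * X.card|} : ℝ)
              ≤ C / p * Real.log (Real.exp 1 * n / X.card))) := by
  set δ := min ε 1 with hδdef
  have hδ : 0 < δ := lt_min hε one_pos
  have hδ1 : δ ≤ 1 := min_le_right _ _
  have hδε : δ ≤ ε := min_le_left _ _
  have hK : 0 < 128 / δ ^ 2 := by positivity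
  refine ⟨2 * (128 / δ ^ 2), by positivity, fun p h0 h1 => ?_⟩
  unfold AAS
  refine tendsto_of_tendsto_of_tendsto_of_le_of_le' lim_bound tendsto_const_nhds ?_
    (Eventually.of_forall fun n => ?_)
  swap
  · rw [← gnpProb_true n p]
    exact gnpProb_mono n p h0 h1 _ _ (fun _ _ => trivial)
  filter_upwards [eventually_ge_atTop 3] with n hn
  refine (good_prob n p δ hn h0 h1 hδ hδ1).trans (gnpProb_mono n p h0 h1 _ _ ?_)
  intro G hG
  set K := 128 / δ ^ 2 with hKdef
  have hl := log_ge_one hn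
  have hKp : 0 < K / p := by positivity
  have h2K : 2 * K / p = 2 * (K / p) := by ring
  have hXw : ∀ X : Finset (Fin n), 2 * K / p * Real.log n ≤ (X.card : ℝ) →
      K / p * Real.log n ≤ (X.card : ℝ) ∧ 128 ≤ (X.card : ℝ) ∧
      1 ≤ Real.log (Real.exp 1 * n / X.card) := by
    intro X hX
    have a : K / p * Real.log n ≤ (X.card : ℝ) := by
      refine le_trans ?_ hX
      rw [h2K]; nlinarith [mul_pos hKp (lt_of_lt_of_le one_pos hl)]
    have b := card_lower hn h0 h1 hδ X a
    have c : (128 : ℝ) ≤ 128 / δ ^ 2 := by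
      rw [le_div_iff₀ (by positivity)]; nlinarith
    have d : (128 : ℝ) ≤ X.card := c.trans b
    refine ⟨a, d, L_ge_one X ?_⟩
    have : (0 : ℝ) < X.card := by linarith
    exact_mod_cast this
  refine ⟨?_, ?_, ?_⟩
  · intro X Y _ hX hY
    obtain ⟨a, b, c⟩ := hXw X hX
    have hg := hG (X, Y) ⟨a, le_trans (by rw [h2K]; nlinarith) hY⟩
    refine hg.trans ?_
    gcongr
  · intro X hX
    obtain ⟨a, b, c⟩ := hXw X hX
    have hx : (0 : ℝ) < X.card := by linarith
    have hg := hG (X, X) ⟨a, le_trans ?_ a⟩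
    · have h3 := (abs_le.1 hg).2
      simp only at h3
      have h4 : (eIn G X : ℝ) ≤ (eXY G X X : ℝ) / 2 := by
        unfold eIn; exact_mod_cast Nat.cast_div_le
      have h5 : δ * (p * X.card * X.card) ≤ 1 * (p * X.card * X.card) := by gcongr
      nlinarith [mul_pos (mul_pos h0 hx) hx]
    · have hn0 : (0 : ℝ) < n := by positivity
      refine mul_le_mul_of_nonneg_left (Real.log_le_log (by positivity) ?_) hKp.le
      rw [div_le_iff₀ hx]
      have := Real.exp_one_lt_d9
      nlinarith
  · intro X hX
    classical
    obtain ⟨a, b, c⟩ := hXw X hX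
    have hx : (0 : ℝ) < X.card := by linarith
    set L := Real.log (Real.exp 1 * n / X.card) with hL
    set B1 : Finset (Fin n) := Finset.univ.filter
      (fun v => (1 + ε) * (p * X.card) < ((nbhdIn G v X).card : ℝ)) with hB1
    set B2 : Finset (Fin n) := Finset.univ.filter
      (fun v => ((nbhdIn G v X).card : ℝ) < (1 - ε) * (p * X.card)) with hB2
    have hsub : Nat.card {v : Fin n |
                ε * (p * X.card) < |((nbhdIn G v X).card : ℝ) - p * X.card|} ≤
        B1.card + B2.card := by
      refine le_trans ?_ (Finset.card_union_le _ _)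
      rw [Nat.card_eq_fintype_card, ← Set.toFinset_card]
      refine Finset.card_le_card ?_
      intro v hv
      simp only [Set.mem_toFinset, Set.mem_ofPred_eq, lt_abs] at hv
      simp only [hB1, hB2, Finset.mem_union, Finset.mem_filter, Finset.mem_univ, true_and]
      rcases hv with hv | hv
      · left; linarith
      · right; linarith
    have hsub' : (Nat.card {v : Fin n |
                ε * (p * X.card) < |((nbhdIn G v X).card : ℝ) - p * X.card|} : ℝ) ≤
        B1.card + B2.card := by exact_mod_cast hsub
    have hKL : 0 < K / p * L := by positivity
    have c1 : (B1.card : ℝ) ≤ K / p * L := by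
      by_contra hcon
      push Not at hcon
      have hpos : (0 : ℝ) < B1.card := hKL.trans hcon
      have hne : B1.Nonempty := Finset.card_pos.1 (by exact_mod_cast hpos)
      have hg := (abs_le.1 (hG (X, B1) ⟨a, hcon.le⟩)).2
      simp only at hg
      have hs : ∑ v ∈ B1, (1 + ε) * (p * X.card) < ∑ v ∈ B1, ((nbhdIn G v X).card : ℝ) :=
        Finset.sum_lt_sum_of_nonempty hne (fun v hv => (Finset.mem_filter.1 hv).2)
      rw [Finset.sum_const, nsmul_eq_mul] at hs
      rw [eXY_eq_nbhd] at hg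
      push_cast at hg
      have h5 : δ * (p * X.card * B1.card) ≤ ε * (p * X.card * B1.card) := by gcongr
      nlinarith
    have c2 : (B2.card : ℝ) ≤ K / p * L := by
      by_contra hcon
      push Not at hcon
      have hpos : (0 : ℝ) < B2.card := hKL.trans hcon
      have hne : B2.Nonempty := Finset.card_pos.1 (by exact_mod_cast hpos)
      have hg := (abs_le.1 (hG (X, B2) ⟨a, hcon.le⟩)).1
      simp only at hg
      have hs : ∑ v ∈ B2, ((nbhdIn G v X).card : ℝ) < ∑ v ∈ B2, (1 - ε) * (p * X.card) :=
        Finset.sum_lt_sum_of_nonempty hne (fun v hv => (Finset.mem_filter.1 hv).2)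
      rw [Finset.sum_const, nsmul_eq_mul] at hs
      rw [eXY_eq_nbhd] at hg
      push_cast at hg
      have h5 : δ * (p * X.card * B2.card) ≤ ε * (p * X.card * B2.card) := by gcongr
      nlinarith
    rw [h2K]
    linarith
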